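/- arXiv:2407.02958 — 2 statements merged into one kernel-verified Lean document; each statement's English description precedes it below -/
import Mathlib

section
/- If a finite tree T is strongly balanced, then T has a perfect matching M and there exists a leaf r of T such that for every vertex v, the unique path in T from r to v alternates between edges in M and edges not in M. -/
namespace SimpleGraph

variable {V : Type*} {T : SimpleGraph V}

theorem IsTree.length_eq_dist (hT : T.IsTree) {u v : V} {p : T.Walk u v} (hp : p.IsPath) :
    p.length = T.dist u v := by
  obtain ⟨q, hq, hql⟩ := hT.connected.exists_path_of_dist u v
  rw [(hT.existsUnique_path u v).unique hp hq, hql]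

/-- In a rooted tree, every vertex other than the root has a unique parent. -/
theorem IsTree.existsUnique_adj_dist_eq_add_one (hT : T.IsTree) {u v : V} (h : v ≠ u) :
    ∃! w, T.Adj v w ∧ T.dist u v = T.dist u w + 1 := by
  obtain ⟨p, hp, hpl⟩ := hT.connected.exists_path_of_dist u v
  have hnil : ¬ p.Nil := Walk.not_nil_of_ne h.symm
  refine ⟨p.penultimate, ⟨(p.adj_penultimate hnil).symm, ?_⟩, ?_⟩
  · have h1 := T.dist_le p.dropLast
    have h2 := Walk.length_dropLast_add_one hnil
    have h3 := hT.dist_eq_dist_add_one_of_adj u (p.adj_penultimate hnil)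
    omega
  · rintro w ⟨hw, hd⟩
    obtain ⟨q, -, hql⟩ := hT.connected.exists_path_of_dist u w
    have hq : (q.concat hw.symm).IsPath :=
      Walk.isPath_of_length_eq_dist _ (by rw [Walk.length_concat, hql, hd])
    rw [(hT.existsUnique_path u v).unique hp hq, Walk.penultimate_concat]

/-- Along a path in a tree, every step leads away from the starting vertex. -/
theorem IsTree.dist_snd_of_mem_darts (hT : T.IsTree) {u v : V} (p : T.Walk u v)
    (hp : p.IsPath) : ∀ d ∈ p.darts, T.dist u d.snd = T.dist u d.fst + 1 := by
  induction p using Walk.concatRec with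
  | Hnil => simp
  | Hconcat p h ih =>
    have hp' := ((Walk.concat_isPath_iff h).mp hp).1
    intro d hd
    rw [Walk.darts_concat, List.concat_eq_append, List.mem_append, List.mem_singleton] at hd
    rcases hd with hd | rfl
    · exact ih hp' d hd
    · rw [← hT.length_eq_dist hp, ← hT.length_eq_dist hp', Walk.length_concat]

/-- The edges of `T` joining a vertex of the class `c = b` to one of its children with respect to
the root `u`. -/
def downwardEdges (T : SimpleGraph V) (c : V → Bool) (b : Bool) (u : V) : T.Subgraph where
  verts := Set.univ
  Adj x y := T.Adj x y ∧
    (c x = b ∧ T.dist u y = T.dist u x + 1 ∨ c y = b ∧ T.dist u x = T.dist u y + 1)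
  adj_sub h := h.1
  edge_vert _ := Set.mem_univ _
  symm := ⟨fun _ _ h => ⟨h.1.symm, h.2.symm⟩⟩

theorem IsTree.downwardEdges_isPerfectMatching (hT : T.IsTree) {c : V → Bool} {b : Bool} {u : V}
    (hc : ∀ x y, T.Adj x y → c x ≠ c y) (hu : c u = b) (hu1 : (T.neighborSet u).ncard = 1)
    (h2 : ∀ v, c v = b → v ≠ u → (T.neighborSet v).ncard = 2) :
    (T.downwardEdges c b u).IsPerfectMatching := by
  refine ⟨fun v _ => ?_, fun v => Set.mem_univ v⟩
  by_cases hv : c v = b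
  · have key : ∃! w, T.Adj v w ∧ T.dist u w = T.dist u v + 1 := by
      by_cases hvu : v = u
      · subst hvu
        obtain ⟨w, hw⟩ := Set.ncard_eq_one.mp hu1
        have hw' : ∀ x, T.Adj v x ↔ x = w := fun x => by
          rw [← mem_neighborSet, hw, Set.mem_singleton_iff]
        have hvw := (hw' w).mpr rfl
        exact ⟨w, ⟨hvw, by simp [dist_eq_one_iff_adj.mpr hvw]⟩, fun y hy => (hw' y).mp hy.1⟩
      · obtain ⟨p, ⟨hp, hpd⟩, huniq⟩ := hT.existsUnique_adj_dist_eq_add_one hvu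
        obtain ⟨x, y, hxy, hs⟩ := Set.ncard_eq_two.mp (h2 v hv hvu)
        have hs' : ∀ z, T.Adj v z ↔ z = x ∨ z = y := fun z => by
          rw [← mem_neighborSet, hs]; rfl
        have hor : ∀ z, T.Adj v z → z ≠ p → T.dist u z = T.dist u v + 1 := fun z hz hzp =>
          (hT.dist_eq_dist_add_one_of_adj u hz).resolve_left fun h => hzp (huniq z ⟨hz, h⟩)
        have hne : ∀ z, T.dist u z = T.dist u v + 1 → z ≠ p := by
          rintro z hz rfl
          omega
        rcases (hs' p).mp hp with rfl | rfl
        · have hy := (hs' y).mpr (Or.inr rfl)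
          exact ⟨y, ⟨hy, hor y hy hxy.symm⟩,
            fun z hz => ((hs' z).mp hz.1).resolve_left (hne z hz.2)⟩
        · have hx := (hs' x).mpr (Or.inl rfl)
          exact ⟨x, ⟨hx, hor x hx hxy⟩,
            fun z hz => ((hs' z).mp hz.1).resolve_right (hne z hz.2)⟩
    refine (existsUnique_congr fun w => ?_).mp key
    refine and_congr_right fun hw => ⟨fun h => Or.inl ⟨hv, h⟩, ?_⟩
    rintro (h | h)
    · exact h.2
    · exact absurd (hv.trans h.1.symm) (hc v w hw)
  · have hvu : v ≠ u := fun h => hv (h ▸ hu)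
    refine (existsUnique_congr fun w => ?_).mp (hT.existsUnique_adj_dist_eq_add_one hvu)
    refine and_congr_right fun hw => ⟨fun h => Or.inr ⟨?_, h⟩, ?_⟩
    · have := hc v w hw
      revert hv this
      cases c v <;> cases c w <;> cases b <;> simp
    · rintro (h | h)
      · exact absurd h.1 hv
      · exact h.2

theorem IsTree.isChain_edges_downwardEdges (hT : T.IsTree) {c : V → Bool} (b : Bool) {u v : V}
    (hc : ∀ x y, T.Adj x y → c x ≠ c y) {p : T.Walk u v} (hp : p.IsPath) :
    p.edges.IsChain fun e f =>
      (e ∈ (T.downwardEdges c b u).edgeSet ↔ f ∉ (T.downwardEdges c b u).edgeSet) := by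
  have hmem : ∀ d ∈ p.darts, (d.edge ∈ (T.downwardEdges c b u).edgeSet ↔ c d.fst = b) := by
    intro d hd
    have hdist := hT.dist_snd_of_mem_darts p hp d hd
    change T.Adj d.fst d.snd ∧ _ ↔ _
    refine ⟨?_, fun h => ⟨d.adj, Or.inl ⟨h, hdist⟩⟩⟩
    rintro ⟨-, h | h⟩
    · exact h.1
    · have hlt : T.dist u d.fst = T.dist u d.snd + 1 := h.2
      omega
  rw [Walk.edges, List.isChain_map]
  refine p.isChain_dartAdj_darts.imp_of_mem_imp fun d e hd he hde => ?_
  rw [hmem d hd, hmem e he]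
  have := hc _ _ d.adj
  rw [show d.snd = e.fst from hde] at this
  revert this
  cases c d.fst <;> cases c e.fst <;> cases b <;> simp

end SimpleGraph


/-- A tree (more generally, a graph) `T` is *strongly balanced* if it admits a proper
2-coloring (i.e. a bipartition of the vertex set) such that on one side of the bipartition
exactly one vertex is a leaf (has degree `1`) and all the other vertices on that side have
degree `2`.  Degrees are expressed via `Set.ncard` of the neighbor set. -/
def StronglyBalanced {V : Type*} (T : SimpleGraph V) : Prop :=
  ∃ c : V → Bool,
    (∀ u v : V, T.Adj u v → c u ≠ c v) ∧
    ∃ b : Bool, ∃ u : V, c u = b ∧ (T.neighborSet u).ncard = 1 ∧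
      ∀ v : V, c v = b → v ≠ u → (T.neighborSet v).ncard = 2

/-- If a finite tree `T` is strongly balanced, then `T` has a perfect
matching `M` and there exists a leaf `r` of `T` such that for every vertex `v`, the unique
path in `T` from `r` to `v` alternates between edges in `M` and edges not in `M`. -/
theorem stronglyBalanced_imp_alternating {V : Type*} [Fintype V]
    (T : SimpleGraph V) (hT : T.IsTree) (hSB : StronglyBalanced T) :
    ∃ M : T.Subgraph, M.IsPerfectMatching ∧
      ∃ r : V, (T.neighborSet r).ncard = 1 ∧
        ∀ (v : V) (p : T.Walk r v), p.IsPath →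
          List.Chain' (fun e f => (e ∈ M.edgeSet ↔ f ∉ M.edgeSet)) p.edges := by
  obtain ⟨c, hc, b, u, hu, hu1, h2⟩ := hSB
  exact ⟨T.downwardEdges c b u, hT.downwardEdges_isPerfectMatching hc hu hu1 h2, u, hu1,
    fun _ _ hp => hT.isChain_edges_downwardEdges b hc hp⟩
end

section
/- Let H be a finite simple graph on a vertex set V with |V| even, and suppose H has exactly one connected component K with def(K) > 0, this component satisfies def(K) = 2i for some integer i ≥ 1, and H has k components with deficiency 0. Then opt(H) = k + i. -/
/-- The maximum cardinality of a matching in a simple graph `H`. -/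
noncomputable def maxMatchingCard {V : Type*} (H : SimpleGraph V) : ℕ :=
  sSup {n : ℕ | ∃ M : H.Subgraph, M.IsMatching ∧ M.edgeSet.ncard = n}

/-- The deficiency of a finite simple graph `H`: the number of vertices minus twice the
maximum cardinality of a matching. -/
noncomputable def deficiency {V : Type*} [Fintype V] (H : SimpleGraph V) : ℕ :=
  Fintype.card V - 2 * maxMatchingCard H

/-- The deficiency of a connected component `K` of `H`: the number of vertices of `K` minus
twice the maximum cardinality of a matching in (the subgraph of `H` induced on) `K`. -/
noncomputable def compDeficiency {V : Type*} (H : SimpleGraph V)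
    (K : H.ConnectedComponent) : ℕ :=
  K.supp.ncard - 2 * maxMatchingCard (H.induce K.supp)

/-- `H` has a perfect matching. -/
def HasPerfectMatching {V : Type*} (H : SimpleGraph V) : Prop :=
  ∃ M : H.Subgraph, M.IsPerfectMatching

/-- The set of cardinalities of sets `F` of non-edges of `H` (unordered pairs of distinct
vertices that are not edges of `H`) whose addition makes `H` connected and perfectly
matchable.  Its least element is `opt H`. -/
def optSet {V : Type*} (H : SimpleGraph V) : Set ℕ :=
  {n : ℕ | ∃ F : Finset (Sym2 V),
    (∀ e ∈ F, ¬ e.IsDiag) ∧ (∀ e ∈ F, e ∉ H.edgeSet) ∧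
    (H ⊔ SimpleGraph.fromEdgeSet (↑F : Set (Sym2 V))).Connected ∧
    HasPerfectMatching (H ⊔ SimpleGraph.fromEdgeSet (↑F : Set (Sym2 V))) ∧
    F.card = n}

/-- `c(H)`: the number of connected components of `H`. -/
noncomputable def numComponents {V : Type*} (H : SimpleGraph V) : ℕ :=
  Nat.card H.ConnectedComponent

/-- `c₊(H)`: the number of connected components of `H` with positive deficiency. -/
noncomputable def cPlus {V : Type*} (H : SimpleGraph V) : ℕ :=
  Nat.card {K : H.ConnectedComponent // 0 < compDeficiency H K}

/-- `c₀(H)`: the number of connected components of `H` with deficiency zero. -/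
noncomputable def cZero {V : Type*} (H : SimpleGraph V) : ℕ :=
  Nat.card {K : H.ConnectedComponent // compDeficiency H K = 0}

theorem Finset.even_card_of_involution {α : Type*} {s : Finset α} {f : α → α}
    (hmem : ∀ a ∈ s, f a ∈ s) (hinv : ∀ a ∈ s, f (f a) = a) (hne : ∀ a ∈ s, f a ≠ a) :
    Even s.card := by
  have h : ∑ _a ∈ s, (1 : ZMod 2) = 0 :=
    Finset.sum_involution (fun a _ => f a) (fun _ _ => by decide)
      (fun a ha _ => hne a ha) hmem hinv
  rw [Finset.sum_const, nsmul_one] at h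
  exact (ZMod.natCast_eq_zero_iff_even).1 h

/-- A function encoding a matching of `G`: it swaps the two ends of each matching edge and
fixes every unmatched vertex. -/
structure SimpleGraph.IsMate {V : Type*} (G : SimpleGraph V) (m : V → V) : Prop where
  invol : ∀ v, m (m v) = v
  adj : ∀ v, m v = v ∨ G.Adj v (m v)

namespace SimpleGraph

variable {V : Type*} {G H : SimpleGraph V} {m : V → V}

theorem Subgraph.IsMatching.ncard_verts [Finite V] {M : G.Subgraph} (hM : M.IsMatching) :
    M.verts.ncard = 2 * M.edgeSet.ncard := by
  classical
  have := Fintype.ofFinite V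
  have h := M.spanningCoe.two_mul_card_edgeFinset
  have hE : M.edgeSet.ncard = M.spanningCoe.edgeFinset.card := by
    rw [← Set.ncard_coe_finset, coe_edgeFinset, Subgraph.edgeSet_spanningCoe]
  rw [hE, h, ← Finset.card_image_of_injOn (f := Prod.fst), ← Set.ncard_coe_finset]
  · congr 1
    ext v
    simp only [Finset.coe_image, Finset.coe_filter, Finset.mem_univ, true_and, Set.mem_image,
      Set.mem_ofPred_eq, Prod.exists, exists_and_right, exists_eq_right, Subgraph.spanningCoe_adj]
    exact ⟨fun hv => (hM hv).exists, fun ⟨w, hw⟩ => hw.fst_mem⟩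
  · rintro ⟨a, b⟩ hab ⟨c, d⟩ hcd (rfl : a = c)
    simp only [Finset.coe_filter, Finset.mem_univ, true_and, Set.mem_ofPred_eq,
      Subgraph.spanningCoe_adj] at hab hcd
    rw [hM.eq_of_adj_left hab hcd]

theorem bddAbove_ncard_matching [Finite V] (G : SimpleGraph V) :
    BddAbove {n : ℕ | ∃ M : G.Subgraph, M.IsMatching ∧ M.edgeSet.ncard = n} := by
  refine ⟨Nat.card V, ?_⟩
  rintro n ⟨M, hM, rfl⟩
  have h₁ := hM.ncard_verts
  have h₂ := Set.ncard_le_card M.verts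
  omega

/-- The matching encoded by a mate function. -/
def IsMate.toSubgraph (hm : G.IsMate m) : G.Subgraph where
  verts := {v | m v ≠ v}
  Adj v w := m v = w ∧ m v ≠ v
  adj_sub := by
    rintro v w ⟨rfl, h⟩
    exact (hm.adj v).resolve_left h
  edge_vert h := h.2
  symm := ⟨by
    rintro v w ⟨rfl, h⟩
    exact ⟨hm.invol v, by rw [hm.invol]; exact h.symm⟩⟩

theorem IsMate.isMatching_toSubgraph (hm : G.IsMate m) : hm.toSubgraph.IsMatching :=
  fun v hv => ⟨m v, ⟨rfl, hv⟩, fun _ h => h.1.symm⟩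

theorem IsMate.hasPerfectMatching (hm : G.IsMate m) (h : ∀ v, m v ≠ v) :
    HasPerfectMatching G :=
  ⟨hm.toSubgraph, hm.isMatching_toSubgraph, h⟩

theorem IsMate.card_le [Finite V] (hm : G.IsMate m) :
    Nat.card V ≤ {v | m v = v}.ncard + 2 * maxMatchingCard G := by
  have h₁ := hm.isMatching_toSubgraph.ncard_verts
  have h₂ : hm.toSubgraph.edgeSet.ncard ≤ maxMatchingCard G :=
    le_csSup (bddAbove_ncard_matching G) ⟨_, hm.isMatching_toSubgraph, rfl⟩
  have h₃ := Set.ncard_add_ncard_compl {v | m v = v}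
  have h₄ : {v | m v = v}ᶜ = hm.toSubgraph.verts := rfl
  rw [h₄] at h₃
  omega

theorem Subgraph.IsMatching.exists_isMate {M : G.Subgraph} (hM : M.IsMatching) :
    ∃ m, G.IsMate m ∧ {v | m v = v} = M.vertsᶜ := by
  classical
  choose! f hf hf' using fun v (hv : v ∈ M.verts) => hM hv
  simp only at hf hf'
  have hmem : ∀ v ∈ M.verts, f v ∈ M.verts := fun v hv => (hf v hv).snd_mem
  refine ⟨fun v => if v ∈ M.verts then f v else v, ⟨fun v => ?_, fun v => ?_⟩, ?_⟩
  · by_cases hv : v ∈ M.verts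
    · simp only [hv, hmem v hv, if_true]
      exact (hf' _ (hmem v hv) v (hf v hv).symm).symm
    · simp [hv]
  · by_cases hv : v ∈ M.verts
    · simp only [hv, if_true]
      exact Or.inr (hf v hv).adj_sub
    · simp [hv]
  · ext v
    by_cases hv : v ∈ M.verts
    · simpa [hv] using (hf v hv).adj_sub.ne'
    · simp [hv]

theorem exists_isMate_card_eq [Finite V] (G : SimpleGraph V) :
    ∃ m, G.IsMate m ∧ Nat.card V = {v | m v = v}.ncard + 2 * maxMatchingCard G := by
  obtain ⟨M, hM, hc⟩ : maxMatchingCard G ∈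
      {n : ℕ | ∃ M : G.Subgraph, M.IsMatching ∧ M.edgeSet.ncard = n} :=
    Nat.sSup_mem ⟨0, ⊥, by intro v hv; simp at hv, by simp⟩ (bddAbove_ncard_matching G)
  obtain ⟨m, hm, hfix⟩ := hM.exists_isMate
  refine ⟨m, hm, ?_⟩
  rw [hfix, ← hc, ← hM.ncard_verts, add_comm, Set.ncard_add_ncard_compl]

theorem exists_isMate_of_hasPerfectMatching (h : HasPerfectMatching G) :
    ∃ m, G.IsMate m ∧ ∀ v, m v ≠ v := by
  obtain ⟨M, hM, hs⟩ := h
  obtain ⟨m, hm, hfix⟩ := hM.exists_isMate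
  refine ⟨m, hm, fun v hv => ?_⟩
  have : v ∈ M.vertsᶜ := hfix ▸ hv
  exact this (hs v)

/-- Maximum matchings of the components glue to a matching of the whole graph. -/
theorem exists_isMate_ncard_eq_compDeficiency [Finite V] (H : SimpleGraph V) :
    ∃ m, H.IsMate m ∧ ∀ K : H.ConnectedComponent,
      {v | v ∈ K.supp ∧ m v = v}.ncard = compDeficiency H K := by
  choose f hf hcard using
    fun K : H.ConnectedComponent => (H.induce K.supp).exists_isMate_card_eq
  let m : V → V := fun v => (f (H.connectedComponentMk v) ⟨v, rfl⟩).1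
  have hm : ∀ (K : H.ConnectedComponent) (v : V) (hv : v ∈ K.supp), m v = (f K ⟨v, hv⟩).1 := by
    rintro K v rfl
    rfl
  refine ⟨m, ⟨fun v => ?_, fun v => ?_⟩, fun K => ?_⟩
  · rw [hm _ (m v) (f (H.connectedComponentMk v) ⟨v, rfl⟩).2]
    exact congrArg Subtype.val ((hf (H.connectedComponentMk v)).invol ⟨v, rfl⟩)
  · exact ((hf (H.connectedComponentMk v)).adj ⟨v, rfl⟩).imp (congrArg Subtype.val) id
  · have h₁ : {v | v ∈ K.supp ∧ m v = v} = Subtype.val '' {v | f K v = v} := by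
      ext v
      constructor
      · rintro ⟨hv, h⟩
        exact ⟨⟨v, hv⟩, Subtype.ext ((hm K v hv).symm.trans h), rfl⟩
      · rintro ⟨w, hw, rfl⟩
        exact ⟨w.2, (hm K _ w.2).trans (congrArg Subtype.val hw)⟩
    rw [h₁, Set.ncard_image_of_injective _ Subtype.val_injective, compDeficiency]
    have := hcard K
    rw [Nat.card_coe_set_eq] at this
    exact (Nat.sub_eq_of_eq_add this).symm

/-- A mate function of a supergraph leaves at least `compDeficiency H K` vertices of `K`
unmatched by edges of `H`. -/
theorem IsMate.compDeficiency_le [Finite V] (hm : G.IsMate m) (K : H.ConnectedComponent) :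
    compDeficiency H K ≤ {v | v ∈ K.supp ∧ ¬ H.Adj v (m v)}.ncard := by
  classical
  let f : K.supp → K.supp := fun v =>
    if h : H.Adj v (m v) then ⟨m v, (K.mem_supp_congr_adj h).1 v.2⟩ else v
  have hf : (H.induce K.supp).IsMate f := by
    refine ⟨fun v => ?_, fun v => ?_⟩
    · by_cases h : H.Adj v (m v)
      · have h' := h.symm
        ext
        simp [f, h, h', hm.invol]
      · simp [f, h]
    · by_cases h : H.Adj v (m v)
      · exact Or.inr (by simp [f, h])
      · exact Or.inl (by simp [f, h])
  have h₁ : Subtype.val '' {v | f v = v} ⊆ {v | v ∈ K.supp ∧ ¬ H.Adj v (m v)} := by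
    rintro _ ⟨v, hv, rfl⟩
    refine ⟨v.2, fun h => h.ne ?_⟩
    have hv' := congrArg Subtype.val hv
    simp only [f, h, dif_pos] at hv'
    exact hv'.symm
  have h₂ := (Set.ncard_image_of_injective _ Subtype.val_injective).symm.trans_le
    (Set.ncard_le_ncard h₁)
  have h₃ := hf.card_le
  rw [Nat.card_coe_set_eq] at h₃
  exact Nat.sub_le_of_le_add (h₃.trans (Nat.add_le_add_right h₂ _))

/-- Merging `c` components into one requires at least `c - 1` edges. -/
theorem card_connectedComponent_le_of_connected_sup [Finite V] (F : Finset (Sym2 V))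
    (h : (H ⊔ fromEdgeSet (F : Set (Sym2 V))).Connected) :
    Nat.card H.ConnectedComponent ≤ F.card + 1 := by
  classical
  let Q : SimpleGraph H.ConnectedComponent :=
    fromEdgeSet (Sym2.map H.connectedComponentMk '' (F : Set (Sym2 V)))
  have hreach : ∀ u v, (H ⊔ fromEdgeSet (F : Set (Sym2 V))).Reachable u v →
      Q.Reachable (H.connectedComponentMk u) (H.connectedComponentMk v) := by
    rintro u v ⟨p⟩
    induction p with
    | nil => rfl
    | @cons u v w huv p ih =>
      refine Reachable.trans ?_ ih
      by_cases he : H.connectedComponentMk u = H.connectedComponentMk v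
      · rw [he]
      rcases huv with huv | huv
      · exact absurd (ConnectedComponent.eq.2 huv.reachable) he
      · refine Adj.reachable ?_
        rw [fromEdgeSet_adj] at huv ⊢
        exact ⟨⟨_, huv.1, rfl⟩, he⟩
  have hQ : Q.Connected := by
    have := h.nonempty.map H.connectedComponentMk
    refine Connected.mk fun K L => ?_
    induction K using ConnectedComponent.ind
    induction L using ConnectedComponent.ind
    exact hreach _ _ (h.preconnected _ _)
  refine hQ.card_vert_le_card_edgeSet_add_one.trans (Nat.add_le_add_right ?_ 1)
  rw [Nat.card_coe_set_eq, edgeSet_fromEdgeSet]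
  calc _ ≤ (Sym2.map H.connectedComponentMk '' (F : Set (Sym2 V))).ncard :=
        Set.ncard_le_ncard Set.sdiff_subset
    _ ≤ (F : Set (Sym2 V)).ncard := Set.ncard_image_le
    _ = F.card := Set.ncard_coe_finset F

/-- If every component other than `K₀` has a perfect matching, then making `H` connected and
perfectly matchable costs half the deficiency of `K₀` on top of the `c(H) - 1` edges needed for
connectedness. -/
theorem two_mul_card_connectedComponent_add_compDeficiency_le [Fintype V]
    {K₀ : H.ConnectedComponent} {μ : V → V} (hμ : H.IsMate μ) (hμ₀ : ∀ v, μ v = v → v ∈ K₀.supp)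
    {F : Finset (Sym2 V)} (hconn : (H ⊔ fromEdgeSet (F : Set (Sym2 V))).Connected)
    (hpm : HasPerfectMatching (H ⊔ fromEdgeSet (F : Set (Sym2 V)))) :
    2 * Nat.card H.ConnectedComponent + compDeficiency H K₀ ≤ 2 * F.card + 2 := by
  classical
  obtain ⟨m, hm, hm₀⟩ := exists_isMate_of_hasPerfectMatching hpm
  have hadj : ∀ v, H.Adj v (m v) ∨ s(v, m v) ∈ F := fun v =>
    ((hm.adj v).resolve_left (hm₀ v)).imp id fun h => by simpa using ((fromEdgeSet_adj _).1 h).1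
  let U : Finset V := {v | v ∈ K₀.supp ∧ ¬ H.Adj v (m v)}
  let S : Finset V := {v | v ∉ K₀.supp ∧ m v ∈ K₀.supp}
  let R : Finset (Sym2 V) := (U ∪ S).image fun v => s(v, m v)
  have hU : compDeficiency H K₀ ≤ U.card := by
    refine (hm.compDeficiency_le K₀).trans_eq ?_
    rw [← Set.ncard_coe_finset]
    simp [U]
  have hS : ∀ v ∈ S, ¬ H.Adj v (m v) := fun v hv h => by
    simp only [S, Finset.mem_filter, Finset.mem_univ, true_and] at hv
    exact hv.1 ((K₀.mem_supp_congr_adj h).2 hv.2)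
  have hRF : R ⊆ F := by
    intro e he
    obtain ⟨v, hv, rfl⟩ := Finset.mem_image.1 he
    rcases Finset.mem_union.1 hv with hv | hv
    · exact (hadj v).resolve_left (Finset.mem_filter.1 hv).2.2
    · exact (hadj v).resolve_left (hS v hv)
  have hR : ∀ u v, s(u, v) ∈ R → m u = v ∧ (u ∈ K₀.supp ∨ v ∈ K₀.supp) := by
    intro u v huv
    obtain ⟨w, hw, hwe⟩ := Finset.mem_image.1 huv
    have hw' : w ∈ K₀.supp ∨ m w ∈ K₀.supp := by
      rcases Finset.mem_union.1 hw with hw | hw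
      · exact Or.inl (Finset.mem_filter.1 hw).2.1
      · exact Or.inr (Finset.mem_filter.1 hw).2.2
    rcases Sym2.eq_iff.1 hwe with ⟨rfl, rfl⟩ | ⟨rfl, rfl⟩
    · exact ⟨rfl, hw'⟩
    · exact ⟨hm.invol _, hw'.symm⟩
  have hUS : U.card + S.card ≤ 2 * R.card := by
    rw [← Finset.card_union_of_disjoint]
    · refine Finset.card_le_mul_card_image _ 2 fun e he => ?_
      obtain ⟨v, hv, rfl⟩ := Finset.mem_image.1 he
      refine (Finset.card_le_card fun w hw => ?_).trans (Finset.card_le_two (a := v) (b := m v))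
      rcases Sym2.eq_iff.1 (Finset.mem_filter.1 hw).2 with h | h
      · simp [h.1]
      · simp [h.1]
    · exact Finset.disjoint_left.2 fun v hv hv' =>
        (Finset.mem_filter.1 hv').2.1 (Finset.mem_filter.1 hv).2.1
  let G' : SimpleGraph V := H ⊔ fromEdgeSet ((F \ R : Finset (Sym2 V)) : Set (Sym2 V))
  have hG' : ∀ u v, (H ⊔ fromEdgeSet (F : Set (Sym2 V))).Adj u v → s(u, v) ∉ R → G'.Adj u v := by
    rintro u v (h | h) huv
    · exact Or.inl h
    · refine Or.inr ?_
      rw [fromEdgeSet_adj] at h ⊢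
      exact ⟨by simpa using ⟨by simpa using h.1, huv⟩, h.2⟩
  obtain ⟨a, ha⟩ := K₀.exists_rep
  have hK₀ : ∀ v ∈ K₀.supp, G'.connectedComponentMk v = G'.connectedComponentMk a := by
    intro v hv
    refine ConnectedComponent.eq.2 (Reachable.mono (le_sup_left : H ≤ G') ?_)
    exact ConnectedComponent.eq.1 (hv.trans ha.symm)
  let C : Finset G'.ConnectedComponent := {c | c ≠ G'.connectedComponentMk a}
  have hne : ∀ c ∈ C, ∀ v, G'.connectedComponentMk v = c → v ∉ K₀.supp := by
    rintro c hc v rfl hv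
    exact (Finset.mem_filter.1 hc).2 (hK₀ v hv)
  have hexit : ∀ c ∈ C, ∃ v ∈ S, G'.connectedComponentMk v = c := by
    intro c hc
    obtain ⟨x, rfl⟩ := c.exists_rep
    obtain ⟨p⟩ := hconn.preconnected x a
    obtain ⟨d, -, hd₁, hd₂⟩ := p.exists_boundary_dart (G'.connectedComponentMk x).supp rfl
      fun h => (Finset.mem_filter.1 hc).2 h.symm
    have hdR : s(d.fst, d.snd) ∈ R := by
      by_contra h
      exact hd₂ ((ConnectedComponent.mem_supp_congr_adj _ (hG' _ _ d.adj h)).1 hd₁)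
    obtain ⟨h₁, h₂⟩ := hR _ _ hdR
    have h₃ := hne _ hc _ hd₁
    refine ⟨d.fst, ?_, hd₁⟩
    simp only [S, Finset.mem_filter, Finset.mem_univ, true_and]
    exact ⟨h₃, h₁ ▸ h₂.resolve_left h₃⟩
  have hCS : 2 * C.card ≤ S.card := by
    refine le_trans ?_ (Finset.card_filter_le S fun v => G'.connectedComponentMk v ∈ C)
    refine Finset.mul_card_image_le_card_of_maps_to (f := G'.connectedComponentMk)
      (fun v hv => (Finset.mem_filter.1 hv).2) 2 fun c hc => ?_
    obtain ⟨x, hxS, hxc⟩ := hexit c hc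
    have h₀ : ({v ∈ {v ∈ S | G'.connectedComponentMk v ∈ C} | G'.connectedComponentMk v = c}) =
        ({v | G'.connectedComponentMk v = c ∧ m v ∈ K₀.supp} : Finset V) := by
      ext v
      simp only [S, Finset.mem_filter, Finset.mem_univ, true_and]
      constructor
      · rintro ⟨⟨⟨-, h⟩, -⟩, h'⟩
        exact ⟨h', h⟩
      · rintro ⟨h, h'⟩
        exact ⟨⟨⟨hne c hc v h, h'⟩, h ▸ hc⟩, h⟩
    rw [h₀]
    have h₁ : Even ({v | G'.connectedComponentMk v = c} : Finset V).card := by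
      refine Finset.even_card_of_involution (f := μ) ?_ (fun v _ => hμ.invol v) ?_
      · simp only [Finset.mem_filter, Finset.mem_univ, true_and]
        rintro v rfl
        rcases hμ.adj v with h | h
        · rw [h]
        · exact ConnectedComponent.eq.2 (Reachable.mono le_sup_left h.symm.reachable)
      · simp only [Finset.mem_filter, Finset.mem_univ, true_and]
        exact fun v hv h => hne c hc v hv (hμ₀ v h)
    have h₂ : Even ({v | G'.connectedComponentMk v = c ∧ m v ∉ K₀.supp} : Finset V).card := by
      refine Finset.even_card_of_involution (f := m) ?_ (fun v _ => hm.invol v) fun v _ => hm₀ v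
      simp only [Finset.mem_filter, Finset.mem_univ, true_and]
      rintro v ⟨hv, hv'⟩
      rw [hm.invol]
      refine ⟨?_, hne c hc v hv⟩
      rw [← hv]
      refine ConnectedComponent.eq.2 (hG' _ _ ((hm.adj v).resolve_left (hm₀ v)) ?_).symm.reachable
      exact fun h => (hR _ _ h).2.elim (hne c hc v hv) hv'
    have h₃ := Finset.card_filter_add_card_filter_not
      (s := ({v | G'.connectedComponentMk v = c} : Finset V)) (fun v => m v ∈ K₀.supp)
    rw [Finset.filter_filter, Finset.filter_filter] at h₃
    have h₄ : 0 < ({v | G'.connectedComponentMk v = c ∧ m v ∈ K₀.supp} : Finset V).card :=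
      Finset.card_pos.2 ⟨x, by simpa [hxc] using (Finset.mem_filter.1 hxS).2.2⟩
    rw [Nat.even_iff] at h₁ h₂
    omega
  have : Nonempty V := ⟨a⟩
  choose! f hfS hf using hexit
  let T : Finset (Sym2 V) := C.image fun c => s(f c, m (f c))
  have hconn' : (H ⊔ fromEdgeSet (((F \ R) ∪ T : Finset (Sym2 V)) : Set (Sym2 V))).Connected := by
    set G'' := H ⊔ fromEdgeSet (((F \ R) ∪ T : Finset (Sym2 V)) : Set (Sym2 V)) with hG''
    have hle : G' ≤ G'' := sup_le_sup_left (fromEdgeSet_mono (by simp)) H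
    refine (connected_iff_exists_forall_reachable _).2 ⟨a, fun v => ?_⟩
    by_cases hv : G'.connectedComponentMk v = G'.connectedComponentMk a
    · exact (ConnectedComponent.eq.1 hv.symm).mono hle
    · have hc : G'.connectedComponentMk v ∈ C := by simpa [C] using hv
      set w := f (G'.connectedComponentMk v)
      have h₁ : G''.Reachable w v := (ConnectedComponent.eq.1 (hf _ hc)).mono hle
      have h₂ : G''.Adj w (m w) := by
        refine Or.inr ((fromEdgeSet_adj _).2 ⟨?_, (hm₀ w).symm⟩)
        exact Finset.mem_union_right _ (Finset.mem_image_of_mem _ hc)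
      have h₃ : G''.Reachable a (m w) :=
        (ConnectedComponent.eq.1 (hK₀ _ (Finset.mem_filter.1 (hfS _ hc)).2.2)).symm.mono hle
      exact h₃.trans (h₂.symm.reachable.trans h₁)
  have h₁ := card_connectedComponent_le_of_connected_sup _ hconn'
  have h₂ := Finset.card_union_le (F \ R) T
  have h₃ : T.card ≤ C.card := Finset.card_image_le
  have h₄ := Finset.card_sdiff_add_card_eq_card hRF
  omega

/-- Adding an edge between two unmatched vertices to the graph and to the matching. -/
theorem IsMate.sup_edge [DecidableEq V] (hm : G.IsMate m) {u w : V} (huw : u ≠ w) (hu : m u = u)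
    (hw : m w = w) : (G ⊔ edge u w).IsMate (m ∘ Equiv.swap u w) := by
  refine ⟨fun v => ?_, fun v => ?_⟩
  · have := hm.invol v
    simp only [Function.comp_apply, Equiv.swap_apply_def]
    grind
  · have := hm.adj v
    simp only [Function.comp_apply, Equiv.swap_apply_def, sup_adj, edge_adj]
    grind

theorem setOf_comp_swap_eq_self [DecidableEq V] {u w : V} (huw : u ≠ w) (hu : m u = u)
    (hw : m w = w) :
    {v | (m ∘ Equiv.swap u w) v = v} = {v | m v = v} \ {u, w} := by
  ext v
  simp only [Function.comp_apply, Equiv.swap_apply_def, Set.mem_ofPred_eq, Set.mem_sdiff,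
    Set.mem_insert_iff, Set.mem_singleton_iff]
  grind

/-- Removing an edge from the matching. -/
theorem IsMate.unmatch [DecidableEq V] (hm : G.IsMate m) (r : V) :
    G.IsMate fun v => if v = r ∨ v = m r then v else m v := by
  refine ⟨fun v => ?_, fun v => ?_⟩
  · have h₁ := hm.invol v
    have h₂ := hm.invol r
    grind
  · have := hm.adj v
    grind

theorem exists_hasPerfectMatching_sup_fromEdgeSet [Finite V] (n : ℕ) :
    ∀ {G : SimpleGraph V} {m : V → V}, G.IsMate m → {v | m v = v}.ncard = 2 * n →
      ∃ F : Finset (Sym2 V), F.card ≤ n ∧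
        HasPerfectMatching (G ⊔ fromEdgeSet (F : Set (Sym2 V))) := by
  classical
  induction n with
  | zero =>
    intro G m hm hfix
    rw [mul_zero, Set.ncard_eq_zero] at hfix
    refine ⟨∅, le_rfl, ?_⟩
    simpa using hm.hasPerfectMatching fun v hv => (hfix ▸ hv : v ∈ (∅ : Set V))
  | succ n ih =>
    intro G m hm hfix
    obtain ⟨u, hu, w, hw, huw⟩ := (Set.one_lt_ncard_iff_nontrivial).1
      (by omega : 1 < {v | m v = v}.ncard)
    obtain ⟨F, hF, hpm⟩ := ih (hm.sup_edge huw hu hw) (by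
      rw [setOf_comp_swap_eq_self huw hu hw, Set.ncard_sdiff (Set.pair_subset hu hw), hfix,
        Set.ncard_pair huw]
      omega)
    refine ⟨insert s(u, w) F, (Finset.card_insert_le _ _).trans (Nat.add_le_add_right hF 1), ?_⟩
    rwa [Finset.coe_insert, Set.insert_eq, fromEdgeSet_union, ← sup_assoc]

theorem exists_connected_hasPerfectMatching_sup_fromEdgeSet [Finite V] {n : ℕ} (hn : 1 ≤ n) (a : V)
    (R : Finset V) : ∀ {G : SimpleGraph V} {m : V → V}, G.IsMate m →
      {v | m v = v}.ncard = 2 * n → (∀ v, m v = v → G.Reachable a v) →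
      (∀ v, G.Reachable a v ∨ ∃ r ∈ R, G.Reachable r v) →
      ∃ F : Finset (Sym2 V), F.card ≤ R.card + n ∧
        (G ⊔ fromEdgeSet (F : Set (Sym2 V))).Connected ∧
        HasPerfectMatching (G ⊔ fromEdgeSet (F : Set (Sym2 V))) := by
  classical
  induction R using Finset.induction_on with
  | empty =>
    intro G m hm hfix _ hreach
    obtain ⟨F, hF, hpm⟩ := exists_hasPerfectMatching_sup_fromEdgeSet n hm hfix
    refine ⟨F, by simpa using hF, ?_, hpm⟩
    refine Connected.mono le_sup_left ((connected_iff_exists_forall_reachable G).2 ⟨a, fun v => ?_⟩)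
    simpa using hreach v
  | insert r R hr ih =>
    intro G m hm hfix hfix' hreach
    rw [Finset.card_insert_of_notMem hr]
    by_cases har : G.Reachable a r
    · obtain ⟨F, hF, h⟩ := ih hm hfix hfix' fun v => by
        rcases hreach v with h | ⟨r', hr', h⟩
        · exact Or.inl h
        · rcases Finset.mem_insert.1 hr' with rfl | hr'
          · exact Or.inl (har.trans h)
          · exact Or.inr ⟨r', hr', h⟩
      exact ⟨F, by omega, h⟩
    · have hrm : m r ≠ r := fun h => har (hfix' r h)
      obtain ⟨u, hu⟩ : {v | m v = v}.Nonempty := Set.nonempty_of_ncard_ne_zero (by omega)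
      have hur : u ≠ r := by rintro rfl; exact hrm hu
      have hum : u ≠ m r := by
        rintro rfl
        exact hrm (hu.symm.trans (hm.invol r))
      have hau : (G ⊔ edge u r).Reachable a u := (hfix' u hu).mono le_sup_left
      have har' : (G ⊔ edge u r).Reachable a r :=
        hau.trans (Adj.reachable (Or.inr (by simp [edge_adj, hur])))
      have ham : (G ⊔ edge u r).Reachable a (m r) :=
        har'.trans (((hm.adj r).resolve_left hrm).reachable.mono le_sup_left)
      have hset : {v | (((fun v => if v = r ∨ v = m r then v else m v) ∘ Equiv.swap u r) v) = v} =
          insert (m r) ({v | m v = v} \ {u}) := by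
        rw [setOf_comp_swap_eq_self hur (by simp [hur, hum, hu.out]) (by simp)]
        ext v
        simp only [Set.mem_ofPred_eq, Set.mem_sdiff, Set.mem_insert_iff, Set.mem_singleton_iff]
        grind
      obtain ⟨F, hF, h⟩ := ih ((hm.unmatch r).sup_edge hur (by simp [hur, hum, hu.out]) (by simp))
        (by
          rw [hset, Set.ncard_insert_of_notMem, Set.ncard_sdiff_singleton_of_mem hu]
          · omega
          · rintro ⟨h, -⟩
            exact hrm (h.symm.trans (hm.invol r)))
        (by
          intro v hv
          have : v ∈ insert (m r) ({v | m v = v} \ {u}) := hset ▸ hv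
          rcases this with rfl | h
          · exact ham
          · exact (hfix' v h.1).mono le_sup_left)
        (by
          intro v
          rcases hreach v with h | ⟨r', hr', h⟩
          · exact Or.inl (h.mono le_sup_left)
          · rcases Finset.mem_insert.1 hr' with rfl | hr'
            · exact Or.inl (har'.trans (h.mono le_sup_left))
            · exact Or.inr ⟨r', hr', h.mono le_sup_left⟩)
      refine ⟨insert s(u, r) F, (Finset.card_insert_le _ _).trans (by omega), ?_⟩
      rwa [Finset.coe_insert, Set.insert_eq, fromEdgeSet_union, ← sup_assoc]

end SimpleGraph

open SimpleGraph in
theorem exists_mem_optSet_card_le {V : Type*} (H : SimpleGraph V) (F : Finset (Sym2 V))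
    (hconn : (H ⊔ fromEdgeSet (F : Set (Sym2 V))).Connected)
    (hpm : HasPerfectMatching (H ⊔ fromEdgeSet (F : Set (Sym2 V)))) :
    ∃ n ∈ optSet H, n ≤ F.card := by
  classical
  have h : H ⊔ fromEdgeSet ((F.filter fun e => ¬ e.IsDiag ∧ e ∉ H.edgeSet : Finset (Sym2 V)) :
      Set (Sym2 V)) = H ⊔ fromEdgeSet (F : Set (Sym2 V)) := by
    ext u v
    simp only [sup_adj, fromEdgeSet_adj, Finset.coe_filter, Set.mem_ofPred_eq, Finset.mem_coe,
      mem_edgeSet, Sym2.mk_isDiag_iff]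
    tauto
  exact ⟨_, ⟨_, fun e he => (Finset.mem_filter.1 he).2.1, fun e he => (Finset.mem_filter.1 he).2.2,
    h ▸ hconn, h ▸ hpm, rfl⟩, Finset.card_filter_le _ _⟩

/-- Case (ii)/(iii) of the proof of Lemma 2. Let `H` be a finite simple
graph on an even vertex set having exactly one connected component `K₀` of positive
deficiency, with `def(K₀) = 2·i` for some `i ≥ 1`, and exactly `k` components of
deficiency `0`.  Then `opt(H) = k + i`. -/
theorem augPMST_unique_deficient_component {V : Type*} [Fintype V] (H : SimpleGraph V)
    (heven : Even (Fintype.card V))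
    (K₀ : H.ConnectedComponent)
    (huniq : ∀ K : H.ConnectedComponent, 0 < compDeficiency H K ↔ K = K₀)
    (i : ℕ) (hi : 1 ≤ i) (hK₀ : compDeficiency H K₀ = 2 * i)
    (k : ℕ) (hk : Nat.card {K : H.ConnectedComponent // compDeficiency H K = 0} = k) :
    IsLeast (optSet H) (k + i) := by
  classical
  obtain ⟨μ, hμ, hdef⟩ := H.exists_isMate_ncard_eq_compDeficiency
  have hμ₀ : ∀ v, μ v = v → v ∈ K₀.supp := by
    intro v hv
    refine (huniq (H.connectedComponentMk v)).1 ?_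
    rw [← hdef, Set.ncard_pos]
    exact ⟨v, rfl, hv⟩
  have hfix : {v | μ v = v}.ncard = 2 * i := by
    rw [← hK₀, ← hdef]
    congr 1
    ext v
    exact ⟨fun h => ⟨hμ₀ v h, h⟩, And.right⟩
  have hzero : ∀ K : H.ConnectedComponent, compDeficiency H K = 0 ↔ K ∈ ({K₀}ᶜ : Finset _) := by
    intro K
    rw [Finset.mem_compl, Finset.mem_singleton, ← huniq, Nat.pos_iff_ne_zero, not_not]
  have hk' : ({K₀}ᶜ : Finset H.ConnectedComponent).card = k := by
    rw [← hk, Nat.card_congr (Equiv.subtypeEquivRight hzero), Nat.card_eq_fintype_card,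
      Fintype.card_coe]
  have hcard : Nat.card H.ConnectedComponent = k + 1 := by
    rw [← hk', Nat.card_eq_fintype_card, ← Finset.card_compl_add_card {K₀},
      Finset.card_singleton]
  have hlower : ∀ n ∈ optSet H, k + i ≤ n := by
    rintro n ⟨F, -, -, hconn, hpm, rfl⟩
    have h := SimpleGraph.two_mul_card_connectedComponent_add_compDeficiency_le hμ hμ₀ hconn hpm
    omega
  refine ⟨?_, hlower⟩
  obtain ⟨a, ha⟩ := K₀.exists_rep
  choose r hr using fun K : H.ConnectedComponent => K.exists_rep
  obtain ⟨F, hF, hconn, hpm⟩ :=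
    SimpleGraph.exists_connected_hasPerfectMatching_sup_fromEdgeSet hi a
      (({K₀}ᶜ : Finset H.ConnectedComponent).image r) hμ hfix
      (fun v hv => SimpleGraph.ConnectedComponent.eq.1 (ha.trans (hμ₀ v hv).symm))
      (fun v => by
        by_cases hv : H.connectedComponentMk v = K₀
        · exact Or.inl (SimpleGraph.ConnectedComponent.eq.1 (ha.trans hv.symm))
        · refine Or.inr ⟨r (H.connectedComponentMk v),
            Finset.mem_image_of_mem _ (by simpa using hv), ?_⟩
          exact SimpleGraph.ConnectedComponent.eq.1 (hr _))
  obtain ⟨n, hn, hnF⟩ := exists_mem_optSet_card_le H F hconn hpm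
  have hR := Finset.card_image_le (s := ({K₀}ᶜ : Finset H.ConnectedComponent)) (f := r)
  have hn' := hlower n hn
  obtain rfl : n = k + i := by omega
  exact hn
end
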